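/- Define μ^1, μ^2 : ℝ² → ℝ by μ^1(x^1,x^2) = x^1 and μ^2 = 0. Then ∂_1∂_2 μ^1 + ∂_2∂_2 μ^2 = 0 identically on ℝ² (so (μ^1,μ^2) satisfies the equation defining the adjoint operator ad(𝒟) : (μ^1,μ^2) ↦ ∂_1∂_2 μ^1 + ∂_2∂_2 μ^2), yet there is no smooth function λ : ℝ² → ℝ with μ^1 = ∂_2 λ and μ^2 = −∂_1 λ (i.e. (μ^1,μ^2) is not in the image of the operator ad(𝒟_1) : λ ↦ (∂_2 λ, −∂_1 λ)). Hence ad(𝒟) does not generate the compatibility conditions of ad(𝒟_1), even though 𝒟_1 ∘ 𝒟 = 0 implies ad(𝒟) ∘ ad(𝒟_1) = 0. -/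

import Mathlib

/-- Partial derivative in the `i`-th coordinate direction of `ℝ² = Fin 2 → ℝ`. -/
noncomputable def pd {n : ℕ} (i : Fin n) (f : (Fin n → ℝ) → ℝ) : (Fin n → ℝ) → ℝ :=
  fun x => fderiv ℝ f x (Pi.single i 1)

/-- Second partial derivative `∂_i ∂_j`. -/
noncomputable def pd2 {n : ℕ} (i j : Fin n) (f : (Fin n → ℝ) → ℝ) : (Fin n → ℝ) → ℝ :=
  pd i (pd j f)

theorem pd_coord {n : ℕ} (i j : Fin n) :
    pd i (fun y : Fin n → ℝ => y j) = fun _ => (Pi.single i 1 : Fin n → ℝ) j := by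
  funext x
  have h : HasFDerivAt (fun y : Fin n → ℝ => y j)
      (ContinuousLinearMap.proj (R := ℝ) (φ := fun _ : Fin n => ℝ) j) x :=
    (ContinuousLinearMap.proj (R := ℝ) (φ := fun _ : Fin n => ℝ) j).hasFDerivAt
  simp [pd, h.fderiv]

theorem pd_const {n : ℕ} (i : Fin n) (c : ℝ) : pd i (fun _ => c) = fun _ => 0 := by
  funext x
  simp [pd]

/-- Partial derivatives of a `C²` function commute. -/
theorem pd2_comm {n : ℕ} (i j : Fin n) {f : (Fin n → ℝ) → ℝ} (hf : ContDiff ℝ 2 f) :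
    pd2 i j f = pd2 j i f := by
  funext x
  have hd : DifferentiableAt ℝ (fderiv ℝ f) x :=
    (hf.fderiv_right (m := 1) (by norm_num)).differentiable (by norm_num) x
  have hs : IsSymmSndFDerivAt ℝ f x := hf.contDiffAt.isSymmSndFDerivAt (by simp)
  have key (u v : Fin n → ℝ) :
      fderiv ℝ (fun y => fderiv ℝ f y u) x v = fderiv ℝ (fderiv ℝ f) x v u := by
    simp [fderiv_clm_apply hd (differentiableAt_const u)]
  simp only [pd2]
  change fderiv ℝ (fun y => fderiv ℝ f y _) x _ = fderiv ℝ (fun y => fderiv ℝ f y _) x _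
  rw [key, key]
  exact hs _ _

/-- The pair `(μ¹, μ²) = (x¹, 0)` satisfies `ad(𝒟)(μ¹,μ²) = ∂_1∂_2 μ¹ + ∂_2∂_2 μ² = 0`,
yet it is not in the image of `ad(𝒟₁) : λ ↦ (∂_2 λ, −∂_1 λ)`: the operator `ad(𝒟)` does
not generate the compatibility conditions of `ad(𝒟₁)`. -/
theorem ad_does_not_generate_CC :
    (∀ x : Fin 2 → ℝ,
        pd2 0 1 (fun y : Fin 2 → ℝ => y 0) x + pd2 1 1 (fun _ : Fin 2 → ℝ => (0 : ℝ)) x = 0)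
    ∧ ¬ ∃ l : (Fin 2 → ℝ) → ℝ, ContDiff ℝ (⊤ : ℕ∞) l ∧
        (∀ x : Fin 2 → ℝ, pd 1 l x = x 0) ∧
        (∀ x : Fin 2 → ℝ, -pd 0 l x = 0) := by
  refine ⟨fun x => by simp only [pd2, pd_coord, pd_const, add_zero], ?_⟩
  rintro ⟨l, hl, h1, h0⟩
  have e1 : pd 1 l = fun x => x 0 := funext h1
  have e0 : pd 0 l = fun _ => 0 := funext fun x => neg_eq_zero.mp (h0 x)
  have h := congrFun (pd2_comm 0 1 (contDiff_infty.mp hl 2)) 0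
  simp [pd2, e1, e0, pd_coord, pd_const] at h
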